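/- Assume the number of voters n ≥ 4 is even and fix a preference relation ▷. An SDS on the tie-breaking Condorcet domain D_C^▷ is strategyproof and non-imposing if and only if it is a mixture of a random dictatorship and the tie-breaking Condorcet rule COND^▷, i.e., f(R) = γ_C·COND^▷(R) + Σ_i γ_i·d_i(R) for all R ∈ D_C^▷, where γ_C ≥ 0, γ_i ≥ 0 for all i, and γ_C + Σ_i γ_i = 1. -/

import Mathlib

open scoped Classical
open Finset

/-- A preference relation: a complete, transitive, and antisymmetric binary relation. -/
def IsPref {A : Type*} (r : A → A → Prop) : Prop :=
  (∀ x y : A, x ≠ y → r x y ∨ r y x) ∧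
  (∀ x y z : A, r x y → r y z → r x z) ∧
  (∀ x y : A, r x y → ¬ r y x)

/-- A preference profile for `n` voters over alternatives `A`. -/
abbrev Prof (n : ℕ) (A : Type*) := Fin n → A → A → Prop

/-- Every voter's relation is a preference relation. -/
def IsProf {n : ℕ} {A : Type*} (R : Prof n A) : Prop := ∀ i, IsPref (R i)

/-- The majority margin `g_R(x,y)`. -/
noncomputable def margin {n : ℕ} {A : Type*} (R : Prof n A) (x y : A) : ℤ :=
  (Nat.card {i : Fin n // R i x y} : ℤ) - (Nat.card {i : Fin n // R i y x} : ℤ)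

/-- `x` is the Condorcet winner of `R`. -/
def CondorcetWinner {n : ℕ} {A : Type*} (R : Prof n A) (x : A) : Prop :=
  ∀ y, y ≠ x → 0 < margin R x y

/-- The Condorcet domain: all profiles admitting a Condorcet winner. -/
def CondorcetDomain (n : ℕ) (A : Type*) : Set (Prof n A) :=
  {R | IsProf R ∧ ∃ x, CondorcetWinner R x}

/-- The `(n+1)`-voter profile `(R, ▷)` obtained from `R` by adding `t` as an extra voter. -/
def tieProf {n : ℕ} {A : Type*} (R : Prof n A) (t : A → A → Prop) : Prof (n + 1) A :=
  Fin.cons t R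

/-- The tie-breaking Condorcet domain `D_C^▷`. -/
def TieCondorcetDomain (n : ℕ) {A : Type*} (t : A → A → Prop) : Set (Prof n A) :=
  {R | IsProf R ∧ ∃ x, CondorcetWinner (tieProf R t) x}

/-- Upper contour set `U(≻, x)`. -/
def UC {A : Type*} (r : A → A → Prop) (x : A) : Set A := {y | r y x ∨ y = x}

/-- Probability that the lottery `p` assigns to the set `S`. -/
noncomputable def mass {A : Type*} [Fintype A] (p : A → ℝ) (S : Set A) : ℝ :=
  ∑ y, S.indicator p y

/-- Stochastic dominance `p ≿^SD q` w.r.t. the preference relation `r`. -/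
def SDdom {A : Type*} [Fintype A] (r : A → A → Prop) (p q : A → ℝ) : Prop :=
  ∀ x, mass q (UC r x) ≤ mass p (UC r x)

/-- `f` is a social decision scheme on the domain `D`: on `D` it returns lotteries. -/
def IsSDS {n : ℕ} {A : Type*} [Fintype A] (D : Set (Prof n A))
    (f : Prof n A → A → ℝ) : Prop :=
  ∀ R ∈ D, (∀ x, 0 ≤ f R x) ∧ (∑ x, f R x) = 1

/-- Strategyproofness of `f` on `D`. -/
def Strategyproof {n : ℕ} {A : Type*} [Fintype A] (D : Set (Prof n A))
    (f : Prof n A → A → ℝ) : Prop :=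
  ∀ R ∈ D, ∀ R' ∈ D, ∀ i : Fin n,
    (∀ j, j ≠ i → R j = R' j) → SDdom (R i) (f R) (f R')

/-- Group-strategyproofness of `f` on `D`. -/
def GroupStrategyproof {n : ℕ} {A : Type*} [Fintype A] (D : Set (Prof n A))
    (f : Prof n A → A → ℝ) : Prop :=
  ∀ R ∈ D, ∀ R' ∈ D, ∀ I : Finset (Fin n), I.Nonempty →
    (∀ j ∉ I, R j = R' j) → ∃ i ∈ I, SDdom (R i) (f R) (f R')

/-- Non-imposition of `f` on `D`. -/
def NonImposing {n : ℕ} {A : Type*} [Fintype A] (D : Set (Prof n A))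
    (f : Prof n A → A → ℝ) : Prop :=
  ∀ x : A, ∃ R ∈ D, f R x = 1

/-- Ex post efficiency of `f` on `D`. -/
def ExPostEfficient {n : ℕ} {A : Type*} [Fintype A] (D : Set (Prof n A))
    (f : Prof n A → A → ℝ) : Prop :=
  ∀ R ∈ D, ∀ x y : A, (∀ i, R i x y) → f R y = 0

/-- `x` is top-ranked by the preference relation `r`. -/
def TopRanked {A : Type*} (r : A → A → Prop) (x : A) : Prop := ∀ y, y ≠ x → r x y

/-- The dictatorship of voter `i`. -/
noncomputable def dict {n : ℕ} {A : Type*} [Fintype A] (i : Fin n) (R : Prof n A) : A → ℝ :=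
  fun x => if TopRanked (R i) x then 1 else 0

/-- The Condorcet rule `COND`. -/
noncomputable def CondRule {n : ℕ} {A : Type*} [Fintype A] : Prof n A → A → ℝ :=
  fun R x => if CondorcetWinner R x then 1 else 0

/-- The tie-breaking Condorcet rule `COND^▷`. -/
noncomputable def TieCondRule {n : ℕ} {A : Type*} [Fintype A] (t : A → A → Prop) :
    Prof n A → A → ℝ :=
  fun R x => if CondorcetWinner (tieProf R t) x then 1 else 0

/-- The relation obtained from `r` by swapping the (adjacent) alternatives `x ≻ y`. -/
def swapRel {A : Type*} (r : A → A → Prop) (x y : A) : A → A → Prop :=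
  fun a b => (a = y ∧ b = x) ∨ (r a b ∧ ¬(a = x ∧ b = y))

/-- `R'` arises from `R` by letting voter `i` swap the adjacent alternatives `x ≻_i y`,
i.e., `R' = R^{i:yx}`. -/
def AdjSwap {n : ℕ} {A : Type*} (R R' : Prof n A) (i : Fin n) (x y : A) : Prop :=
  x ≠ y ∧ R i x y ∧ (∀ z, z ≠ x → z ≠ y → ¬(R i x z ∧ R i z y)) ∧
  R' i = swapRel (R i) x y ∧ (∀ j, j ≠ i → R' j = R j)

/-- A single ad-path step inside `D`. -/
def Step {n : ℕ} {A : Type*} (D : Set (Prof n A)) (R R' : Prof n A) : Prop :=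
  R ∈ D ∧ R' ∈ D ∧ ∃ i x y, AdjSwap R R' i x y

/-- A single ad-path step inside `D` in which the alternative `a` is not swapped. -/
def StepAvoiding {n : ℕ} {A : Type*} (D : Set (Prof n A)) (a : A) (R R' : Prof n A) : Prop :=
  R ∈ D ∧ R' ∈ D ∧ ∃ i x y, AdjSwap R R' i x y ∧ x ≠ a ∧ y ≠ a

/-- There is an ad-path from `R` to `R'` inside `D`. -/
def AdPath {n : ℕ} {A : Type*} (D : Set (Prof n A)) (R R' : Prof n A) : Prop :=
  R ∈ D ∧ R' ∈ D ∧ Relation.ReflTransGen (Step D) R R'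

/-- There is an ad-path from `R` to `R'` inside `D` along which `a` is never swapped. -/
def AdPathAvoiding {n : ℕ} {A : Type*} (D : Set (Prof n A)) (a : A) (R R' : Prof n A) : Prop :=
  R ∈ D ∧ R' ∈ D ∧ Relation.ReflTransGen (StepAvoiding D a) R R'

/-- `D` is weakly connected. -/
def WeaklyConnected {n : ℕ} {A : Type*} (D : Set (Prof n A)) : Prop :=
  ∀ R ∈ D, ∀ R' ∈ D, AdPath D R R'

/-- `D` is connected. -/
def Connected {n : ℕ} {A : Type*} (D : Set (Prof n A)) : Prop :=
  WeaklyConnected D ∧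
  ∀ a : A, ∀ R ∈ D, ∀ R' ∈ D, (∀ i, UC (R i) a = UC (R' i) a) → AdPathAvoiding D a R R'

namespace IsPref

variable {A : Type*} {r : A → A → Prop}

theorem total (h : IsPref r) {x y : A} (hxy : x ≠ y) : r x y ∨ r y x := h.1 x y hxy

theorem trans (h : IsPref r) {x y z : A} (hxy : r x y) (hyz : r y z) : r x z :=
  h.2.1 x y z hxy hyz

theorem asymm (h : IsPref r) {x y : A} (hxy : r x y) : ¬ r y x := h.2.2 x y hxy

theorem irrefl (h : IsPref r) (x : A) : ¬ r x x := fun hx => h.asymm hx hx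

theorem wellFounded [Finite A] (h : IsPref r) : WellFounded r :=
  haveI : IsTrans A r := ⟨fun _ _ _ => h.trans⟩
  haveI : Std.Irrefl r := ⟨h.irrefl⟩
  Finite.wellFounded_of_trans_of_irrefl r

theorem flip (h : IsPref r) : IsPref (fun a b => r b a) :=
  ⟨fun _ _ hxy => (h.total hxy).symm, fun _ _ _ hxy hyz => h.trans hyz hxy,
    fun _ _ hxy => h.asymm hxy⟩

theorem exists_topRanked [Finite A] [Nonempty A] (h : IsPref r) : ∃ x, TopRanked r x := by
  obtain ⟨m, -, hm⟩ := h.wellFounded.has_min Set.univ Set.univ_nonempty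
  exact ⟨m, fun y hy => (h.total hy).resolve_left (hm y trivial)⟩

theorem topRanked_unique (h : IsPref r) {x y : A} (hx : TopRanked r x) (hy : TopRanked r y) :
    x = y := by
  by_contra hne
  exact h.asymm (hx y (Ne.symm hne)) (hy x hne)

end IsPref

/-- The relation obtained from `r` by moving all alternatives of `U` to the top. -/
def raiseSet {A : Type*} (U : Set A) (r : A → A → Prop) : A → A → Prop :=
  fun a b => (a ∈ U ∧ b ∉ U) ∨ ((a ∈ U ↔ b ∈ U) ∧ r a b)

/-- The relation obtained from `r` by moving `x` to the top. -/
def raise {A : Type*} (x : A) (r : A → A → Prop) : A → A → Prop :=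
  fun a b => (a = x ∧ b ≠ x) ∨ (a ≠ x ∧ b ≠ x ∧ r a b)

theorem IsPref.raiseSet {A : Type*} {r : A → A → Prop} (h : IsPref r) (U : Set A) :
    IsPref (raiseSet U r) := by
  obtain ⟨h1, h2, h3⟩ := h
  refine ⟨fun x y hxy => ?_, fun x y z => ?_, fun x y => ?_⟩
  · have := h1 x y hxy
    simp only [_root_.raiseSet]; tauto
  · have := h2 x y z
    simp only [_root_.raiseSet]; tauto
  · have := h3 x y
    simp only [_root_.raiseSet]; tauto

theorem IsPref.raise {A : Type*} {r : A → A → Prop} (h : IsPref r) (x : A) :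
    IsPref (raise x r) := by
  obtain ⟨h1, h2, h3⟩ := h
  refine ⟨fun a b hab => ?_, fun a b c => ?_, fun a b => ?_⟩
  · have := h1 a b hab
    simp only [_root_.raise]; grind
  · have := h2 a b c
    simp only [_root_.raise]; tauto
  · have := h3 a b
    simp only [_root_.raise]; tauto

theorem topRanked_raise {A : Type*} (r : A → A → Prop) (x : A) : TopRanked (raise x r) x :=
  fun _ hy => Or.inl ⟨rfl, hy⟩

section Mass

variable {A : Type*} [Fintype A]

theorem mass_insert (p : A → ℝ) {y : A} {U : Set A} (hy : y ∉ U) :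
    mass p (insert y U) = p y + mass p U := by
  have : ∀ z, (insert y U).indicator p z = (if z = y then p y else 0) + U.indicator p z := by
    intro z
    by_cases hz : z = y
    · subst hz; simp [hy]
    · by_cases hU : z ∈ U <;> simp [hz, hU]
  simp [mass, this, Finset.sum_add_distrib]

theorem SDdom.mass_le {r : A → A → Prop} {p q : A → ℝ} (hr : IsPref r) (hpq : SDdom r p q)
    {S : Set A} (hS : ∀ a ∈ S, ∀ b, r b a → b ∈ S) : mass q S ≤ mass p S := by
  rcases S.eq_empty_or_nonempty with rfl | hne
  · simp [mass]
  obtain ⟨m, hmS, hm⟩ := hr.flip.wellFounded.has_min S hne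
  have : S = UC r m := by
    ext b
    refine ⟨fun hb => ?_, fun hb => ?_⟩
    · by_cases hbm : b = m
      · exact Or.inr hbm
      · exact Or.inl ((hr.total hbm).resolve_right (hm b hb))
    · rcases hb with hb | rfl
      · exact hS m hmS b hb
      · exact hmS
  rw [this]
  exact hpq m

end Mass

/-- Whether `x` beats `y` in the presence of the tie-breaking voter `t` when exactly the voters
in `Q` prefer `x` to `y`. -/
def Beats {n : ℕ} {A : Type*} (t : A → A → Prop) (x y : A) (Q : Finset (Fin n)) : Prop :=
  n + 1 < 2 * (#Q + if t x y then 1 else 0)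

theorem Beats.mono {n : ℕ} {A : Type*} {t : A → A → Prop} {x y : A} {Q Q' : Finset (Fin n)}
    (h : Beats t x y Q) (hQ : Q ⊆ Q') : Beats t x y Q' := by
  have := card_le_card hQ
  unfold Beats at *
  omega

/-- `x` beats `y` in the profile `(R, t)`. -/
def Wins {n : ℕ} {A : Type*} (t : A → A → Prop) (R : Prof n A) (x y : A) : Prop :=
  Beats t x y {i | R i x y}

/-- `x` beats every other alternative in the profile `(R, t)`. -/
def WinsAll {n : ℕ} {A : Type*} (t : A → A → Prop) (R : Prof n A) (x : A) : Prop :=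
  ∀ y, y ≠ x → Wins t R x y

section Domain

variable {n : ℕ} {A : Type*} {t : A → A → Prop} {R R' : Prof n A} {x y : A}

theorem Beats.wins {Q : Finset (Fin n)} (h : Beats t x y Q) (hQ : ∀ i ∈ Q, R i x y) :
    Wins t R x y :=
  h.mono fun i hi => by simpa using hQ i hi

theorem Wins.mono (h : Wins t R x y) (hR : ∀ i, R i x y → R' i x y) : Wins t R' x y :=
  Beats.wins h fun i hi => hR i (by simpa using hi)

theorem card_filter_swap (hR : IsProf R) (hxy : x ≠ y) :
    #{i | R i x y} + #{i | R i y x} = n := by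
  have h : (univ.filter fun i => R i y x) = univ.filter fun i => ¬ R i x y :=
    filter_congr fun i _ =>
      ⟨fun h => (hR i).asymm h, fun h => ((hR i).total hxy).resolve_left h⟩
  rw [h, card_filter_add_card_filter_not]
  simp

theorem margin_tieProf_pos_iff (ht : IsPref t) (hR : IsProf R) (hxy : x ≠ y) :
    0 < margin (tieProf R t) x y ↔ Wins t R x y := by
  have key : ∀ a b : A, Nat.card {i : Fin (n + 1) // tieProf R t i a b} =
      #{i | R i a b} + if t a b then 1 else 0 := by
    intro a b
    rw [Nat.card_eq_fintype_card, Fintype.card_subtype, Fin.card_filter_univ_succ]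
    by_cases h : t a b <;> simp [tieProf, h]
  have h1 := card_filter_swap hR hxy
  have h2 : ((if t x y then 1 else 0) + if t y x then 1 else 0) = 1 := by
    rcases ht.total hxy with h | h <;> simp [h, ht.asymm h]
  unfold margin Wins Beats
  rw [key, key]
  omega

theorem condorcetWinner_tieProf_iff (ht : IsPref t) (hR : IsProf R) :
    CondorcetWinner (tieProf R t) x ↔ WinsAll t R x :=
  forall_congr' fun _ => imp_congr_right fun hy => margin_tieProf_pos_iff ht hR (Ne.symm hy)

theorem mem_tieCondorcetDomain_iff (ht : IsPref t) :
    R ∈ TieCondorcetDomain n t ↔ IsProf R ∧ ∃ x, WinsAll t R x :=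
  and_congr_right fun hR => exists_congr fun _ => condorcetWinner_tieProf_iff ht hR

theorem Wins.not_symm (ht : IsPref t) (hR : IsProf R) (hxy : x ≠ y) (h : Wins t R x y) :
    ¬ Wins t R y x := by
  have h1 := card_filter_swap hR hxy
  have h2 : ((if t x y then 1 else 0) + if t y x then 1 else 0) = 1 := by
    rcases ht.total hxy with h | h <;> simp [h, ht.asymm h]
  unfold Wins Beats at *
  omega

theorem wins_or_wins (hn : Even n) (ht : IsPref t) (hR : IsProf R) (hxy : x ≠ y) :
    Wins t R x y ∨ Wins t R y x := by
  have h1 := card_filter_swap hR hxy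
  have h2 : ((if t x y then 1 else 0) + if t y x then 1 else 0) = 1 := by
    rcases ht.total hxy with h | h <;> simp [h, ht.asymm h]
  obtain ⟨k, hk⟩ := hn
  unfold Wins Beats at *
  omega

theorem WinsAll.unique (ht : IsPref t) (hR : IsProf R) (hx : WinsAll t R x)
    (hy : WinsAll t R y) : x = y := by
  by_contra hne
  exact (hx y (Ne.symm hne)).not_symm ht hR hne (hy x hne)

theorem WinsAll.mono (h : WinsAll t R x) (hR : ∀ i z, R i x z → R' i x z) : WinsAll t R' x :=
  fun z hz => (h z hz).mono fun i => hR i z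

theorem wins_of_forall (hn : 4 ≤ n) (hR : ∀ i, R i x y) : Wins t R x y := by
  refine Beats.wins (Q := univ) ?_ fun i _ => hR i
  unfold Beats
  simp only [card_univ, Fintype.card_fin]
  omega

theorem winsAll_of_topRanked (hn : 4 ≤ n) (hx : ∀ i, TopRanked (R i) x) : WinsAll t R x :=
  fun y hy => wins_of_forall hn fun i => hx i y hy

end Domain

/-- The standing assumptions of the characterization. -/
structure Admissible {n : ℕ} {A : Type*} [Fintype A] (t : A → A → Prop)
    (f : Prof n A → A → ℝ) : Prop where
  four_le : 4 ≤ n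
  even : Even n
  three_le : 3 ≤ Fintype.card A
  pref : IsPref t
  sds : IsSDS (TieCondorcetDomain n t) f
  strategyproof : Strategyproof (TieCondorcetDomain n t) f
  nonImposing : NonImposing (TieCondorcetDomain n t) f

namespace Admissible

variable {n : ℕ} {A : Type*} [Fintype A] {t : A → A → Prop} {f : Prof n A → A → ℝ}
  {R R' : Prof n A} {x y z w : A}

theorem mem (h : Admissible t f) (hR : IsProf R) (hx : WinsAll t R x) :
    R ∈ TieCondorcetDomain n t :=
  (mem_tieCondorcetDomain_iff h.pref).2 ⟨hR, x, hx⟩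

theorem wins_of_forall (h : Admissible t f) (hR : ∀ i, R i x y) : Wins t R x y :=
  _root_.wins_of_forall h.four_le hR

theorem wins_of_forall_ne (h : Admissible t f) (i : Fin n) (hR : ∀ j, j ≠ i → R j x y) :
    Wins t R x y := by
  have := h.four_le
  refine Beats.wins (Q := univ.erase i) ?_ fun j hj => hR j (ne_of_mem_erase hj)
  unfold Beats
  simp only [mem_univ, card_erase_of_mem, card_univ, Fintype.card_fin]
  omega

/-- If two alternatives beat all others, then one of them is the winner. -/
theorem mem_of_two (h : Admissible t f) (hR : IsProf R) (hxw : x ≠ w)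
    (hx : ∀ z, z ≠ x → z ≠ w → Wins t R x z) (hw : ∀ z, z ≠ x → z ≠ w → Wins t R w z) :
    R ∈ TieCondorcetDomain n t := by
  rcases wins_or_wins h.even h.pref hR hxw with h1 | h1
  · refine h.mem (x := x) hR fun z hz => ?_
    by_cases hzw : z = w
    · exact hzw ▸ h1
    · exact hx z hz hzw
  · refine h.mem (x := w) hR fun z hz => ?_
    by_cases hzx : z = x
    · exact hzx ▸ h1
    · exact hw z hzx hz

theorem mem_between (h : Admissible t f) (hR : IsProf R) (hR' : IsProf R')
    (hx : WinsAll t R x) (hl : ∀ i z, R i x z → R' i x z) {T : Prof n A}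
    (hT : ∀ i, T i = R i ∨ T i = R' i) : T ∈ TieCondorcetDomain n t := by
  refine h.mem (x := x) (fun i => ?_) (hx.mono fun i z hz => ?_)
  · rcases hT i with e | e <;> rw [e]
    exacts [hR i, hR' i]
  · rcases hT i with e | e <;> rw [e]
    exacts [hz, hl i z hz]

theorem le_of_change (h : Admissible t f) (hR : R ∈ TieCondorcetDomain n t)
    (hR' : R' ∈ TieCondorcetDomain n t) {i : Fin n} (hi : ∀ j, j ≠ i → R j = R' j)
    (hy : ∀ a, R' i a y → ∀ b, R i b a → R' i b y) : f R y ≤ f R' y := by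
  have hp := h.strategyproof R hR R' hR' i hi
  have hp' := h.strategyproof R' hR' R hR i fun j hj => (hi j hj).symm
  have hyU : y ∉ {a | R' i a y} := (hR'.1 i).irrefl y
  have h1 := hp.mass_le (S := {a | R' i a y}) (hR.1 i) hy
  have h2 := hp'.mass_le (S := insert y {a | R' i a y}) (hR'.1 i) (by
    rintro a (rfl | ha) b hb
    · exact Or.inr hb
    · exact Or.inr ((hR'.1 i).trans hb ha))
  rw [mass_insert _ hyU, mass_insert _ hyU] at h2
  linarith

/-- Changing the preferences of several voters one after another. -/
theorem le_of_changes (h : Admissible t f)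
    (hT : ∀ T : Prof n A, (∀ i, T i = R i ∨ T i = R' i) → T ∈ TieCondorcetDomain n t)
    (hy : ∀ i a, R' i a y → ∀ b, R i b a → R' i b y) : f R y ≤ f R' y := by
  have key : ∀ S : Finset (Fin n), f R y ≤ f (fun i => if i ∈ S then R' i else R i) y := by
    intro S
    induction S using Finset.induction_on with
    | empty => simp
    | insert i S hi ih =>
      refine ih.trans (h.le_of_change (i := i) (hT _ fun j => ?_) (hT _ fun j => ?_)
        (fun j hj => ?_) ?_)
      · by_cases hj : j ∈ S <;> simp [hj]
      · by_cases hj : j ∈ insert i S <;> simp [hj]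
      · simp [hj]
      · simpa [hi] using hy i
  simpa using key univ

theorem eq_of_changes (h : Admissible t f)
    (hT : ∀ T : Prof n A, (∀ i, T i = R i ∨ T i = R' i) → T ∈ TieCondorcetDomain n t)
    (hy : ∀ i a, R i a y ↔ R' i a y) : f R y = f R' y := by
  have hR : IsProf R := (hT R fun _ => Or.inl rfl).1
  have hR' : IsProf R' := (hT R' fun _ => Or.inr rfl).1
  refine le_antisymm (h.le_of_changes hT fun i a ha b hb => ?_)
    (h.le_of_changes (fun T h => hT T fun i => (h i).symm) fun i a ha b hb => ?_)
  · exact (hy i b).1 ((hR i).trans hb ((hy i a).2 ha))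
  · exact (hy i b).2 ((hR' i).trans hb ((hy i a).1 ha))

theorem nonneg (h : Admissible t f) (hR : R ∈ TieCondorcetDomain n t) (x : A) : 0 ≤ f R x :=
  (h.sds R hR).1 x

theorem sum_eq_one (h : Admissible t f) (hR : R ∈ TieCondorcetDomain n t) : ∑ x, f R x = 1 :=
  (h.sds R hR).2

theorem sum_le_one (h : Admissible t f) (hR : R ∈ TieCondorcetDomain n t) (s : Finset A) :
    ∑ x ∈ s, f R x ≤ 1 :=
  h.sum_eq_one hR ▸ sum_le_sum_of_subset_of_nonneg (subset_univ s) fun x _ _ => h.nonneg hR x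

theorem winsAll_of_topRanked (h : Admissible t f) (hx : ∀ i, TopRanked (R i) x) :
    WinsAll t R x :=
  _root_.winsAll_of_topRanked h.four_le hx

theorem unanimous (h : Admissible t f) (hR : IsProf R) (hx : ∀ i, TopRanked (R i) x) :
    f R x = 1 := by
  suffices ∃ R', IsProf R' ∧ (∀ i, TopRanked (R' i) x) ∧ 1 ≤ f R' x by
    obtain ⟨R', hR', hx', h1⟩ := this
    have hw := h.winsAll_of_topRanked hx'
    have e : f R' x = f R x := by
      refine h.eq_of_changes (fun T => h.mem_between hR' hR hw fun i z hz => ?_) fun i a => ?_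
      · refine hx i z ?_
        rintro rfl
        exact (hR' i).irrefl _ hz
      · have key : ∀ r, IsPref r → TopRanked r x → ¬ r a x := fun r hr hrx ha => by
          by_cases hax : a = x
          · exact hr.irrefl x (hax ▸ ha)
          · exact hr.asymm ha (hrx a hax)
        exact iff_of_false (key _ (hR' i) (hx' i)) (key _ (hR i) (hx i))
    have := h.sum_le_one (h.mem hR (h.winsAll_of_topRanked hx)) {x}
    rw [sum_singleton] at this
    linarith
  obtain ⟨R₀, hR₀, hf⟩ := h.nonImposing x
  obtain ⟨hP, w, hw⟩ := (mem_tieCondorcetDomain_iff h.pref).1 hR₀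
  by_cases hwx : w = x
  · subst hwx
    refine ⟨fun i => raise w (R₀ i), fun i => (hP i).raise w, fun i => topRanked_raise _ _, ?_⟩
    rw [← hf]
    refine h.le_of_changes (fun T => h.mem_between hP (fun i => (hP i).raise w) hw ?_) ?_
    · intro i z hz
      have := (hP i).irrefl w
      simp only [raise]; grind
    · intro i a ha
      simp only [raise] at ha; grind
  · have hxw := Ne.symm hwx
    let R₁ : Prof n A := fun i => if R₀ i w x then raise w (R₀ i) else R₀ i
    let R₂ : Prof n A := fun i => if R₀ i w x then raise w (raise x t) else raise x (raise w t)
    let R₃ : Prof n A := fun _ => raise x (raise w t)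
    have hP₁ : IsProf R₁ := fun i => by
      simp only [R₁]; split_ifs
      exacts [(hP i).raise w, hP i]
    have hP₂ : IsProf R₂ := fun i => by
      simp only [R₂]; split_ifs
      exacts [(h.pref.raise x).raise w, (h.pref.raise w).raise x]
    have hP₃ : IsProf R₃ := fun i => (h.pref.raise w).raise x
    have l₁ : ∀ i z, R₀ i w z → R₁ i w z := fun i z hz => by
      have := (hP i).irrefl w
      simp only [R₁, ite_apply, raise]; grind
    have l₂ : ∀ i z, R₁ i w z → R₂ i w z := fun i z hz => by
      obtain ⟨p₁, p₂, p₃⟩ := hP i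
      have := p₁ w x hwx
      simp only [R₁, R₂, ite_apply, raise] at hz ⊢; grind
    have hw₁ := hw.mono l₁
    have e₁ : f R₀ x = f R₁ x := by
      refine h.eq_of_changes (fun T => h.mem_between hP hP₁ hw l₁) fun i a => ?_
      simp only [R₁, ite_apply, raise]; grind
    have e₂ : f R₁ x ≤ f R₂ x := by
      refine h.le_of_changes (fun T => h.mem_between hP₁ hP₂ hw₁ l₂) fun i a ha b hb => ?_
      simp only [R₁, R₂, ite_apply, raise] at ha hb ⊢; grind
    have e₃ : f R₂ x ≤ f R₃ x := by
      refine h.le_of_changes (fun T hT => ?_) fun i a ha => ?_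
      · have key : ∀ i, T i = raise w (raise x t) ∨ T i = raise x (raise w t) := fun i => by
          simp only [R₂, R₃] at hT; grind
        refine h.mem_of_two (fun i => ?_) hwx (fun z h1 h2 => ?_) fun z h1 h2 => ?_
        · rcases key i with e | e <;> rw [e]
          exacts [(h.pref.raise x).raise w, (h.pref.raise w).raise x]
        all_goals
          refine h.wins_of_forall fun i => ?_
          rcases key i with e | e <;> simp [e, raise, h1, h2, hwx, hxw]
      · simp only [R₃, raise] at ha; grind
    exact ⟨R₃, hP₃, fun i => topRanked_raise _ _, by linarith⟩

theorem eq_zero_of_topRanked (h : Admissible t f) (hR : IsProf R)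
    (hx : ∀ i, TopRanked (R i) x) (hzx : z ≠ x) : f R z = 0 := by
  have hm := h.mem hR (h.winsAll_of_topRanked hx)
  have h1 := h.sum_le_one hm {x, z}
  rw [sum_pair (Ne.symm hzx), h.unanimous hR hx] at h1
  linarith [h.nonneg hm z]

/-- Unanimously dominated alternatives have probability zero. -/
theorem eq_zero_of_dominated (h : Admissible t f) (hR : R ∈ TieCondorcetDomain n t)
    (hxz : ∀ i, R i x z) : f R z = 0 := by
  have hn := h.four_le
  obtain ⟨hP, w, hw⟩ := (mem_tieCondorcetDomain_iff h.pref).1 hR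
  have hzx : z ≠ x := by
    rintro rfl
    exact (hP ⟨0, by omega⟩).irrefl z (hxz _)
  have hwz : w ≠ z := by
    rintro rfl
    exact (h.wins_of_forall hxz).not_symm h.pref hP (Ne.symm hzx) (hw x (Ne.symm hzx))
  by_cases hwx : w = x
  · subst hwx
    have hP' : IsProf fun i => raise w (R i) := fun i => (hP i).raise w
    rw [← h.eq_zero_of_topRanked hP' (fun i => topRanked_raise _ _) hzx]
    refine h.eq_of_changes (fun T => h.mem_between hP hP' hw fun i y hy => ?_) fun i a => ?_
    · have := (hP i).irrefl w
      simp only [raise]; grind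
    · have := hxz i
      simp only [raise]; grind
  · let R₁ : Prof n A := fun i => if R i w z then raise w (R i) else raise x (R i)
    let R₂ : Prof n A := fun i =>
      if R i w z then raise w (raise x (R i)) else raise x (raise z (raise w t))
    let R₃ : Prof n A := fun i =>
      if R i w z then raise x (raise w (R i)) else raise x (raise z (raise w t))
    have hP₁ : IsProf R₁ := fun i => by
      simp only [R₁]; split_ifs
      exacts [(hP i).raise w, (hP i).raise x]
    have hP₂ : IsProf R₂ := fun i => by
      simp only [R₂]; split_ifs
      exacts [((hP i).raise x).raise w, ((h.pref.raise w).raise z).raise x]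
    have hP₃ : IsProf R₃ := fun i => by
      simp only [R₃]; split_ifs
      exacts [((hP i).raise w).raise x, ((h.pref.raise w).raise z).raise x]
    have l₁ : ∀ i a, R i w a → R₁ i w a := fun i a ha => by
      obtain ⟨p₁, p₂, p₃⟩ := hP i
      have := hxz i
      have := p₁ w z hwz
      have := p₃ w w
      simp only [R₁, ite_apply, raise]; grind
    have l₂ : ∀ i a, R₁ i w a → R₂ i w a := fun i a ha => by
      obtain ⟨p₁, p₂, p₃⟩ := hP i
      have := hxz i
      have := p₁ w z hwz
      have := p₃ w w
      simp only [R₁, R₂, ite_apply, raise] at ha ⊢; grind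
    have hw₁ := hw.mono l₁
    have e₁ : f R z = f R₁ z := by
      refine h.eq_of_changes (fun T => h.mem_between hP hP₁ hw l₁) fun i a => ?_
      have := hxz i
      simp only [R₁, ite_apply, raise]; grind
    have e₂ : f R₁ z ≤ f R₂ z := by
      refine h.le_of_changes (fun T => h.mem_between hP₁ hP₂ hw₁ l₂) fun i a ha b hb => ?_
      have := hxz i
      have := (hP i).2.1 b a z
      simp only [R₁, R₂, ite_apply, raise] at ha hb ⊢; grind
    have e₃ : f R₂ z = f R₃ z := by
      refine h.eq_of_changes (fun T hT => ?_) fun i a => ?_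
      · refine h.mem_of_two (x := x) (w := w) (fun i => ?_) (Ne.symm hwx)
          (fun a h1 h2 => h.wins_of_forall fun i => ?_) fun a h1 h2 => (hw a h2).mono fun i ha => ?_
        · rcases hT i with e | e <;> rw [e]
          exacts [hP₂ i, hP₃ i]
        · rcases hT i with e | e <;> rw [e] <;> simp only [R₂, R₃, ite_apply, raise] <;> grind
        · obtain ⟨p₁, p₂, p₃⟩ := hP i
          have := p₁ w z hwz
          rcases hT i with e | e <;> rw [e] <;> simp only [R₂, R₃, ite_apply, raise] <;> grind
      · have := hxz i
        simp only [R₂, R₃, ite_apply, raise]; grind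
    have e₄ : f R₃ z = 0 := by
      refine h.eq_zero_of_topRanked hP₃ (fun i => ?_) hzx
      simp only [R₃]; split_ifs <;> exact topRanked_raise _ _
    linarith [h.nonneg hR z]

end Admissible

/-- The profile in which the voters in `S` rank `y` first and `x` second, while all others rank
`x` first and `y` second. -/
noncomputable def duel {n : ℕ} {A : Type*} (t : A → A → Prop) (x y : A) (S : Finset (Fin n)) :
    Prof n A :=
  fun i => if i ∈ S then raise y (raise x t) else raise x (raise y t)

namespace Admissible

variable {n : ℕ} {A : Type*} [Fintype A] {t : A → A → Prop} {f : Prof n A → A → ℝ}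
  {R : Prof n A} {x y z w : A} {S : Finset (Fin n)} {i : Fin n}

theorem isProf_duel (h : Admissible t f) : IsProf (duel t x y S) := fun i => by
  simp only [duel]; split_ifs
  exacts [(h.pref.raise x).raise y, (h.pref.raise y).raise x]

theorem winsAll_duel (h : Admissible t f) (hxy : x ≠ y) (hS : Beats t x y Sᶜ) :
    WinsAll t (duel t x y S) x := fun z hz => by
  by_cases hzy : z = y
  · subst hzy
    refine hS.wins fun i hi => ?_
    rw [mem_compl] at hi
    simp [duel, hi, raise, hz]
  · refine h.wins_of_forall fun i => ?_
    simp only [duel, ite_apply, raise]; grind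

theorem add_eq_one (h : Admissible t f) (hR : R ∈ TieCondorcetDomain n t) (hxy : x ≠ y)
    (h0 : ∀ w, w ≠ x → w ≠ y → f R w = 0) : f R x + f R y = 1 := by
  rw [← h.sum_eq_one hR, Fintype.sum_eq_add x y hxy]
  exact fun w hw => h0 w hw.1 hw.2

theorem eq_duel (h : Admissible t f) (hR : IsProf R) (hxy : x ≠ y) (hw : WinsAll t R x)
    (hS : ∀ i ∈ S, TopRanked (R i) y) (hS' : ∀ i ∉ S, R i x y) :
    f R y = f (duel t x y S) y := by
  let R₁ : Prof n A := fun i => if i ∈ S then raise y (raise x (R i)) else raise x (R i)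
  have hP₁ : IsProf R₁ := fun i => by
    simp only [R₁]; split_ifs
    exacts [((hR i).raise x).raise y, (hR i).raise x]
  have hD := h.isProf_duel (x := x) (y := y) (S := S)
  have hSt : ∀ i ∈ S, ∀ a, ¬ R i a y := fun i hi a ha => by
    by_cases hay : a = y
    · exact (hR i).irrefl y (hay ▸ ha)
    · exact (hR i).asymm ha (hS i hi a hay)
  have l₁ : ∀ i z, R i x z → R₁ i x z := fun i z hz => by
    have := hSt i
    have := (hR i).irrefl x
    simp only [R₁, ite_apply, raise]; grind
  have l₂ : ∀ i z, R₁ i x z → duel t x y S i x z := fun i z hz => by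
    simp only [R₁, duel, ite_apply, raise] at hz ⊢; grind
  have hw₁ := hw.mono l₁
  have hm₁ := h.mem hP₁ hw₁
  have hm₂ := h.mem hD (hw₁.mono l₂)
  have e₁ : f R y = f R₁ y := by
    refine h.eq_of_changes (fun T => h.mem_between hR hP₁ hw l₁) fun i a => ?_
    have := hSt i
    have := hS' i
    simp only [R₁, ite_apply, raise]; grind
  have e₂ : f R₁ x = f (duel t x y S) x := by
    refine h.eq_of_changes (fun T => h.mem_between hP₁ hD hw₁ l₂) fun i a => ?_
    simp only [R₁, duel, ite_apply, raise]; grind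
  have s₁ := h.add_eq_one hm₁ hxy fun w h1 h2 => h.eq_zero_of_dominated (x := x) hm₁ fun i => by
    simp only [R₁, ite_apply, raise]; grind
  have s₂ := h.add_eq_one hm₂ hxy fun w h1 h2 => h.eq_zero_of_dominated (x := x) hm₂ fun i => by
    simp only [duel, ite_apply, raise]; grind
  linarith

/-- The probability of a non-winner is at least its probability in the corresponding duel. -/
theorem duel_le (h : Admissible t f) (hR : IsProf R) (hw : WinsAll t R x) (hyx : y ≠ x) :
    f (duel t x y {i | TopRanked (R i) y}) y ≤ f R y := by
  let R' : Prof n A := fun i =>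
    if TopRanked (R i) y then R i else raiseSet {a | R i a y} (raise x (R i))
  have hP' : IsProf R' := fun i => by
    simp only [R']; split_ifs
    exacts [hR i, ((hR i).raise x).raiseSet _]
  have l : ∀ i z, R i x z → R' i x z := fun i z hz => by
    obtain ⟨p₁, p₂, p₃⟩ := hR i
    have := p₃ x x
    have := p₂ x z y
    simp only [R', ite_apply, raiseSet, raise, Set.mem_ofPred_eq]; grind
  rw [← h.eq_duel (R := R') hP' (Ne.symm hyx) (hw.mono l)]
  · refine h.le_of_changes (fun T hT => h.mem_between hR hP' hw l fun i => (hT i).symm) ?_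
    intro i a ha b hb
    obtain ⟨p₁, p₂, p₃⟩ := hR i
    have := p₃ y y
    have := p₂ b a y
    simp only [R', ite_apply, raiseSet, raise, Set.mem_ofPred_eq] at hb; grind
  · intro i hi
    simp only [mem_filter, mem_univ, true_and] at hi
    simp [R', hi]
  · intro i hi
    simp only [mem_filter, mem_univ, true_and] at hi
    have := (hR i).irrefl y
    simp only [R', hi, if_false, raiseSet, raise, Set.mem_ofPred_eq]; grind

theorem duel_congr_left (h : Admissible t f) (hxy : x ≠ y) (hzy : z ≠ y) (hxz : x ≠ z)
    (hx : Beats t x y Sᶜ) (hz : Beats t z y Sᶜ) :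
    f (duel t x y S) y = f (duel t z y S) y := by
  let P : A → A → Prof n A := fun x z i =>
    if i ∈ S then raise y (raise x (raise z t)) else raise x (raise z (raise y t))
  have hP : ∀ x z, IsProf (P x z) := fun x z i => by
    simp only [P]; split_ifs
    exacts [((h.pref.raise z).raise x).raise y, ((h.pref.raise y).raise z).raise x]
  have hwin : ∀ x z, x ≠ y → z ≠ y → x ≠ z → Beats t x y Sᶜ → WinsAll t (P x z) x := by
    intro x z hxy hzy hxz hx a ha
    by_cases hay : a = y
    · subst hay
      refine hx.wins fun i hi => ?_
      rw [mem_compl] at hi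
      simp [P, hi, raise, ha]
    · refine h.wins_of_forall fun i => ?_
      simp only [P, ite_apply, raise]; grind
  have e : ∀ x z, x ≠ y → z ≠ y → x ≠ z → Beats t x y Sᶜ →
      f (P x z) y = f (duel t x y S) y := by
    intro x z hxy hzy hxz hx
    refine h.eq_duel (hP x z) hxy (hwin x z hxy hzy hxz hx) (fun i hi => ?_) fun i hi => ?_
    · simp only [P, hi, if_true]; exact topRanked_raise _ _
    · simp [P, hi, raise, Ne.symm hxy]
  rw [← e x z hxy hzy hxz hx, ← e z x hzy hxy (Ne.symm hxz) hz]
  refine h.eq_of_changes (fun T hT => ?_) fun i a => ?_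
  · refine h.mem_of_two (x := x) (w := z) (fun i => ?_) hxz (fun a h1 h2 => ?_) fun a h1 h2 => ?_
    · rcases hT i with e | e <;> rw [e] <;> exact hP _ _ i
    · by_cases hay : a = y
      · subst hay
        refine hx.wins fun i hi => ?_
        rw [mem_compl] at hi
        rcases hT i with e | e <;> rw [e] <;> simp [P, hi, raise, h1, h2, em]
      · refine h.wins_of_forall fun i => ?_
        rcases hT i with e | e <;> rw [e] <;> simp only [P, ite_apply, raise] <;> grind
    · by_cases hay : a = y
      · subst hay
        refine hz.wins fun i hi => ?_
        rw [mem_compl] at hi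
        rcases hT i with e | e <;> rw [e] <;> simp [P, hi, raise, h1, h2, em]
      · refine h.wins_of_forall fun i => ?_
        rcases hT i with e | e <;> rw [e] <;> simp only [P, ite_apply, raise] <;> grind
  · simp only [P, ite_apply, raise]; grind

theorem add_add_eq_one (h : Admissible t f) (hR : R ∈ TieCondorcetDomain n t) (hxy : x ≠ y)
    (hxz : x ≠ z) (hyz : y ≠ z) (h0 : ∀ w, w ≠ x → w ≠ y → w ≠ z → f R w = 0) :
    f R x + f R y + f R z = 1 := by
  rw [← h.sum_eq_one hR, ← sum_subset (subset_univ {x, y, z}), sum_insert, sum_pair hyz, add_assoc]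
  · simp [hxy, hxz]
  · intro w _ hw
    simp only [mem_insert, mem_singleton, not_or] at hw
    exact h0 w hw.1 hw.2.1 hw.2.2

theorem duel_insert (h : Admissible t f) (hxy : x ≠ y) (hxz : x ≠ z) (hyz : y ≠ z) (hi : i ∉ S)
    (hB : Beats t x y (insert i S)ᶜ) :
    f (duel t x y (insert i S)) y = f (duel t x y S) y + f (duel t x z {i}) z := by
  let P : Prof n A := fun j => if j = i then raise z (raise y (raise x t)) else
    if j ∈ S then raise y (raise x (raise z t)) else raise x (raise z (raise y t))
  let P₁ : Prof n A := fun j => if j = i then raise y (raise z (raise x t)) else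
    if j ∈ S then raise y (raise x (raise z t)) else raise x (raise y (raise z t))
  let P₂ : Prof n A := fun j => if j = i then raise z (raise y (raise x t)) else
    if j ∈ S then raise y (raise z (raise x t)) else raise z (raise x (raise y t))
  have ht := h.pref
  have hP : IsProf P := fun j => by
    simp only [P]; split_ifs
    exacts [((ht.raise _).raise _).raise _, ((ht.raise _).raise _).raise _,
      ((ht.raise _).raise _).raise _]
  have hP₁ : IsProf P₁ := fun j => by
    simp only [P₁]; split_ifs
    exacts [((ht.raise _).raise _).raise _, ((ht.raise _).raise _).raise _,
      ((ht.raise _).raise _).raise _]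
  have hP₂ : IsProf P₂ := fun j => by
    simp only [P₂]; split_ifs
    exacts [((ht.raise _).raise _).raise _, ((ht.raise _).raise _).raise _,
      ((ht.raise _).raise _).raise _]
  have hBx : Beats t x y Sᶜ := hB.mono (compl_subset_compl.2 (subset_insert i S))
  have hBz : Beats t z y Sᶜ := by
    have hc := card_erase_add_one (mem_compl.2 hi)
    rw [compl_insert] at hB
    unfold Beats at *
    split_ifs at * <;> omega
  have hw : WinsAll t P x := fun a ha => by
    by_cases hay : a = y
    · subst hay
      refine hB.wins fun j hj => ?_
      simp only [mem_compl, mem_insert, not_or] at hj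
      simp [P, hj, raise, ha]
    · by_cases haz : a = z
      · subst haz
        refine h.wins_of_forall_ne i fun j hj => ?_
        simp only [P, ite_apply, raise]; grind
      · refine h.wins_of_forall fun j => ?_
        simp only [P, ite_apply, raise]; grind
  have l₁ : ∀ j a, P j x a → P₁ j x a := fun j a ha => by
    simp only [P, P₁, ite_apply, raise] at ha ⊢; grind
  have hw₁ := hw.mono l₁
  have hw₂ : WinsAll t P₂ z := fun a ha => by
    by_cases hay : a = y
    · subst hay
      refine hBz.wins fun j hj => ?_
      simp only [mem_compl] at hj
      simp only [P₂, ite_apply, raise]; grind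
    · refine h.wins_of_forall fun j => ?_
      simp only [P₂, ite_apply, raise]; grind
  have hm := h.mem hP hw
  have hm₁ := h.mem hP₁ hw₁
  have e₁ : f P x = f P₁ x := by
    refine h.eq_of_changes (fun T => h.mem_between hP hP₁ hw l₁) fun j a => ?_
    simp only [P, P₁, ite_apply, raise]; grind
  have e₂ : f P y = f P₂ y := by
    refine h.eq_of_changes (fun T hT => ?_) fun j a => ?_
    · refine h.mem_of_two (x := x) (w := z) (fun i => ?_) hxz (fun a h1 h2 => ?_)
        fun a h1 h2 => ?_
      · rcases hT i with e | e <;> rw [e]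
        exacts [hP i, hP₂ i]
      · by_cases hay : a = y
        · subst hay
          refine hB.wins fun j hj => ?_
          simp only [mem_compl, mem_insert, not_or] at hj
          rcases hT j with e | e <;> rw [e] <;> simp [P, P₂, hj, raise, h1, h2, em]
        · refine h.wins_of_forall fun i => ?_
          rcases hT i with e | e <;> rw [e] <;> simp only [P, P₂, ite_apply, raise] <;> grind
      · by_cases hay : a = y
        · subst hay
          refine hBz.wins fun j hj => ?_
          simp only [mem_compl] at hj
          rcases hT j with e | e <;> rw [e] <;> simp only [P, P₂, ite_apply, raise] <;> grind
        · refine h.wins_of_forall fun i => ?_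
          rcases hT i with e | e <;> rw [e] <;> simp only [P, P₂, ite_apply, raise] <;> grind
    · simp only [P, P₂, ite_apply, raise]; grind
  have d₁ : f P₁ y = f (duel t x y (insert i S)) y := by
    refine h.eq_duel hP₁ hxy hw₁ (fun j hj a ha => ?_) fun j hj => ?_ <;>
      rw [mem_insert] at hj <;> simp only [P₁, ite_apply, raise] <;> grind
  have d₂ : f P z = f (duel t x z {i}) z := by
    refine h.eq_duel hP hxz hw (fun j hj a ha => ?_) fun j hj => ?_ <;>
      rw [mem_singleton] at hj <;> simp only [P, ite_apply, raise] <;> grind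
  have d₃ : f P₂ y = f (duel t z y S) y := by
    refine h.eq_duel hP₂ (Ne.symm hyz) hw₂ (fun j hj a ha => ?_) fun j hj => ?_ <;>
      simp only [P₂, ite_apply, raise] <;> grind
  have d₄ := h.duel_congr_left hxy (Ne.symm hyz) hxz hBx hBz
  have s₁ := h.add_eq_one hm₁ hxy fun a h1 h2 => h.eq_zero_of_dominated (x := y) hm₁ fun j => by
    simp only [P₁, ite_apply, raise]; grind
  have s := h.add_add_eq_one hm hxy hxz hyz fun a h1 h2 h3 =>
    h.eq_zero_of_dominated (x := x) hm fun j => by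
      simp only [P, ite_apply, raise]; grind
  linarith

theorem exists_third (h : Admissible t f) (x y : A) : ∃ z, z ≠ x ∧ z ≠ y := by
  by_contra! hz
  have h1 : (univ : Finset A) ⊆ {x, y} := fun z _ => by
    have := hz z
    simp only [mem_insert, mem_singleton]; tauto
  have h2 := (card_le_card h1).trans card_le_two
  have h3 := h.three_le
  rw [card_univ] at h2
  omega

theorem beats_compl_singleton (h : Admissible t f) (i : Fin n) : Beats t x y {i}ᶜ := by
  have := h.four_le
  unfold Beats
  rw [card_compl, card_singleton, Fintype.card_fin]
  omega

theorem duel_empty (h : Admissible t f) (hxy : x ≠ y) : f (duel t x y ∅) y = 0 :=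
  h.eq_zero_of_topRanked h.isProf_duel (x := x)
    (fun i => by simp only [duel, notMem_empty, if_false]; exact topRanked_raise _ _) (Ne.symm hxy)

theorem duel_singleton_congr_right (h : Admissible t f) (hxy : x ≠ y) (hxz : x ≠ z) :
    f (duel t x y {i}) y = f (duel t x z {i}) z := by
  by_cases hyz : y = z
  · rw [hyz]
  have := h.duel_insert hxy hxz hyz (notMem_empty i) (by simpa using h.beats_compl_singleton i)
  rw [h.duel_empty hxy] at this
  simpa using this

theorem duel_singleton_congr_left (h : Admissible t f) (hxy : x ≠ y) (hzy : z ≠ y) :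
    f (duel t x y {i}) y = f (duel t z y {i}) y := by
  by_cases hxz : x = z
  · rw [hxz]
  exact h.duel_congr_left hxy hzy hxz (h.beats_compl_singleton i) (h.beats_compl_singleton i)

theorem duel_singleton_congr (h : Admissible t f) (hxy : x ≠ y) (hzw : z ≠ w) :
    f (duel t x y {i}) y = f (duel t z w {i}) w := by
  by_cases hzy : z = y
  · subst hzy
    obtain ⟨v, hvx, hvz⟩ := h.exists_third x z
    rw [h.duel_singleton_congr_right hxy (Ne.symm hvx),
      h.duel_singleton_congr_left (Ne.symm hvx) (Ne.symm hvz),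
      h.duel_singleton_congr_right (Ne.symm hvz) hzw]
  · rw [h.duel_singleton_congr_left hxy hzy, h.duel_singleton_congr_right hzy hzw]

/-- In duels, every voter has a fixed nonnegative weight. -/
theorem exists_weight (h : Admissible t f) : ∃ γ : Fin n → ℝ, (∀ i, 0 ≤ γ i) ∧
    ∀ x y, x ≠ y → ∀ S : Finset (Fin n), Beats t x y Sᶜ → f (duel t x y S) y = ∑ i ∈ S, γ i := by
  obtain ⟨a, b, hab⟩ := Fintype.exists_pair_of_one_lt_card (by have := h.three_le; omega :
    1 < Fintype.card A)
  refine ⟨fun i => f (duel t a b {i}) b, fun i => ?_, fun x y hxy S => ?_⟩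
  · exact h.nonneg (h.mem h.isProf_duel (h.winsAll_duel hab (h.beats_compl_singleton i))) b
  · induction S using Finset.induction_on with
    | empty => exact fun _ => h.duel_empty hxy
    | insert i S hi ih =>
      intro hB
      obtain ⟨z, hzx, hzy⟩ := h.exists_third x y
      rw [h.duel_insert hxy (Ne.symm hzx) (Ne.symm hzy) hi hB, sum_insert hi,
        ih (hB.mono (compl_subset_compl.2 (subset_insert i S))),
        h.duel_singleton_congr (Ne.symm hzx) hab, add_comm]

end Admissible

section Dict

variable {n : ℕ} {A : Type*} [Fintype A] {R : Prof n A}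

theorem sum_mul_dict (γ : Fin n → ℝ) (R : Prof n A) (x : A) :
    ∑ i, γ i * dict i R x = ∑ i with TopRanked (R i) x, γ i := by
  simp [dict, sum_filter]

theorem sum_dict (hR : IsProf R) [Nonempty A] (i : Fin n) : ∑ x, dict i R x = 1 := by
  obtain ⟨a, ha⟩ := (hR i).exists_topRanked
  have h0 : ∀ b, b ≠ a → dict i R b = 0 := fun b hb =>
    if_neg fun hb' => hb ((hR i).topRanked_unique hb' ha)
  rw [Fintype.sum_eq_single a h0]
  simp [dict, ha]

theorem sum_sum_mul_dict (hR : IsProf R) [Nonempty A] (γ : Fin n → ℝ) :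
    ∑ x, ∑ i, γ i * dict i R x = ∑ i, γ i := by
  rw [sum_comm]
  refine sum_congr rfl fun i _ => ?_
  rw [← mul_sum, sum_dict hR, mul_one]

end Dict

namespace Admissible

variable {n : ℕ} {A : Type*} [Fintype A] {t : A → A → Prop} {f : Prof n A → A → ℝ}
  {R : Prof n A} {x y : A} {γ : Fin n → ℝ}

theorem nonempty (h : Admissible t f) : Nonempty A :=
  Fintype.card_pos_iff.1 (by have := h.three_le; omega)

theorem weight_le (h : Admissible t f)
    (hγ : ∀ x y, x ≠ y → ∀ S : Finset (Fin n), Beats t x y Sᶜ →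
      f (duel t x y S) y = ∑ i ∈ S, γ i)
    (hR : IsProf R) (hw : WinsAll t R x) (hyx : y ≠ x) :
    ∑ i, γ i * dict i R y ≤ f R y := by
  rw [sum_mul_dict, ← hγ x y (Ne.symm hyx)]
  · exact h.duel_le hR hw hyx
  · refine Beats.mono (hw y hyx) fun i hi => ?_
    simp only [mem_filter, mem_univ, true_and, mem_compl] at hi ⊢
    exact fun hy => (hR i).asymm hi (hy x (Ne.symm hyx))

theorem le_weight (h : Admissible t f)
    (hγ : ∀ x y, x ≠ y → ∀ S : Finset (Fin n), Beats t x y Sᶜ →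
      f (duel t x y S) y = ∑ i ∈ S, γ i)
    (hR : IsProf R) (hw : WinsAll t R x) (hyx : y ≠ x) :
    f R y ≤ ∑ i, γ i * dict i R y := by
  have := h.nonempty
  choose top htop using fun i => (hR i).exists_topRanked
  let R₁ : Prof n A := fun i => if R i x y then raise x (R i) else R i
  let R₂ : Prof n A := fun i =>
    if R i x y then raise x (raise y t) else raise (top i) (raise y (raise x t))
  let R₃ : Prof n A := fun i =>
    if R i x y then raise x (raise y t) else raise y (raise (top i) (raise x t))
  have hxy := Ne.symm hyx
  have ht := h.pref
  have hP₁ : IsProf R₁ := fun i => by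
    simp only [R₁]; split_ifs
    exacts [(hR i).raise x, hR i]
  have hP₂ : IsProf R₂ := fun i => by
    simp only [R₂]; split_ifs
    exacts [(ht.raise _).raise _, ((ht.raise _).raise _).raise _]
  have hP₃ : IsProf R₃ := fun i => by
    simp only [R₃]; split_ifs
    exacts [(ht.raise _).raise _, ((ht.raise _).raise _).raise _]
  have hnt : ∀ i a, ¬ R i a (top i) := fun i a ha => by
    by_cases hat : a = top i
    · exact (hR i).irrefl _ (hat ▸ ha)
    · exact (hR i).asymm ha (htop i a hat)
  have htx : ∀ i, ¬ R i x y → top i ≠ x := fun i hi he => hi (he ▸ htop i y (by rw [he]; exact hyx))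
  have l₁ : ∀ i a, R i x a → R₁ i x a := fun i a ha => by
    have := (hR i).irrefl x
    simp only [R₁, ite_apply, raise]; grind
  have l₂ : ∀ i a, R₁ i x a → R₂ i x a := fun i a ha => by
    have := (hR i).irrefl x
    have := hnt i x
    have := htx i
    simp only [R₁, R₂, ite_apply, raise] at ha ⊢; grind
  have l₃ : ∀ i a, R₂ i x a → R₃ i x a := fun i a ha => by
    simp only [R₂, R₃, ite_apply, raise] at ha ⊢; grind
  have hw₁ := hw.mono l₁
  have hw₂ := hw₁.mono l₂
  have hw₃ := hw₂.mono l₃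
  have hm₂ := h.mem hP₂ hw₂
  have hm₃ := h.mem hP₃ hw₃
  have e₁ : f R y = f R₁ y := by
    refine h.eq_of_changes (fun T => h.mem_between hR hP₁ hw l₁) fun i a => ?_
    simp only [R₁, ite_apply, raise]; grind
  have e₂ : f R₁ y ≤ f R₂ y := by
    refine h.le_of_changes (fun T => h.mem_between hP₁ hP₂ hw₁ l₂) fun i a ha b hb => ?_
    have := hnt i b
    simp only [R₁, R₂, ite_apply, raise] at ha hb ⊢; grind
  have e₃ : f R₂ x = f R₃ x := by
    refine h.eq_of_changes (fun T => h.mem_between hP₂ hP₃ hw₂ l₃) fun i a => ?_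
    have := htx i
    simp only [R₂, R₃, ite_apply, raise]; grind
  have d₃ : f R₃ y = ∑ i with ¬ R i x y, γ i := by
    rw [← hγ x y hxy]
    · refine h.eq_duel hP₃ hxy hw₃ (fun i hi a ha => ?_) fun i hi => ?_ <;>
        simp only [mem_filter, mem_univ, true_and] at hi <;>
        simp only [R₃, ite_apply, raise] <;> grind
    · refine Beats.mono (hw y hyx) fun i hi => ?_
      simpa using hi
  have s₃ := h.add_eq_one hm₃ hxy fun a h1 h2 => h.eq_zero_of_dominated (x := y) hm₃ fun i => by
    have := htx i
    simp only [R₃, ite_apply, raise]; grind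
  have dx : ∑ i, γ i * dict i R₂ x = ∑ i with R i x y, γ i := by
    rw [sum_mul_dict]
    refine sum_congr (filter_congr fun i _ => ⟨fun hi => ?_, fun hi => ?_⟩) fun _ _ => rfl
    · by_contra hc
      have hi' := hi (top i) (htx i hc)
      have := htx i hc
      simp only [R₂, ite_apply, raise] at hi'; grind
    · simp only [R₂, hi, if_true]; exact topRanked_raise _ _
  have dy : ∑ i, γ i * dict i R₂ y = ∑ i, γ i * dict i R y := by
    rw [sum_mul_dict, sum_mul_dict]
    refine sum_congr (filter_congr fun i _ => ⟨fun hi => ?_, fun hi => ?_⟩) fun _ _ => rfl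
    · have hxi := hi x hxy
      have : top i = y := by
        by_contra hc
        have hi' := hi (top i) hc
        simp only [R₂, ite_apply, raise] at hi' hxi; grind
      exact this ▸ htop i
    · have hty : top i = y := (hR i).topRanked_unique (htop i) hi
      have hc : ¬ R i x y := (hR i).asymm (hi x hxy)
      simp only [R₂, hc, if_false, hty]; exact topRanked_raise _ _
  have split := sum_filter_add_sum_filter_not univ (fun i => R i x y) γ
  have tot₁ := h.sum_eq_one hm₂
  have tot₂ := sum_sum_mul_dict hP₂ γ
  have hu : ({x, y} : Finset A) ⊆ univ := subset_univ _
  rw [← sum_sdiff hu, sum_pair hxy] at tot₁ tot₂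
  have rest : ∑ a ∈ univ \ {x, y}, ∑ i, γ i * dict i R₂ a ≤ ∑ a ∈ univ \ {x, y}, f R₂ a :=
    sum_le_sum fun a ha => h.weight_le hγ hP₂ hw₂ (by
      simp only [mem_sdiff, mem_insert, mem_singleton, not_or] at ha
      exact ha.2.1)
  linarith

theorem eq_mixture (h : Admissible t f) : ∃ (γC : ℝ) (γ : Fin n → ℝ),
    0 ≤ γC ∧ (∀ i, 0 ≤ γ i) ∧ γC + ∑ i, γ i = 1 ∧ ∀ R ∈ TieCondorcetDomain n t, ∀ x,
      f R x = γC * TieCondRule t R x + ∑ i, γ i * dict i R x := by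
  have := h.nonempty
  obtain ⟨γ, hγ0, hγ⟩ := h.exists_weight
  have other : ∀ R x y, IsProf R → WinsAll t R x → y ≠ x → f R y = ∑ i, γ i * dict i R y :=
    fun R x y hR hw hyx =>
      le_antisymm (h.le_weight hγ hR hw hyx) (h.weight_le hγ hR hw hyx)
  have winner : ∀ R x, IsProf R → WinsAll t R x →
      f R x = 1 - ∑ i, γ i + ∑ i, γ i * dict i R x := by
    intro R x hR hw
    have tot₁ := h.sum_eq_one (h.mem hR hw)
    have tot₂ := sum_sum_mul_dict hR γ
    rw [← add_sum_erase _ _ (mem_univ x)] at tot₁ tot₂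
    rw [sum_congr rfl fun y hy => other R x y hR hw (ne_of_mem_erase hy)] at tot₁
    linarith
  refine ⟨1 - ∑ i, γ i, γ, ?_, hγ0, by ring, fun R hR y => ?_⟩
  · obtain ⟨x, hx⟩ := h.pref.exists_topRanked
    obtain ⟨y, hyx, -⟩ := h.exists_third x x
    obtain ⟨z, hzx, hzy⟩ := h.exists_third x y
    obtain ⟨k, hk⟩ := h.even
    obtain ⟨S, -, hS⟩ := exists_subset_card_eq (s := (univ : Finset (Fin n))) (n := k)
      (by simp; omega)
    let P : Prof n A := fun i =>
      if i ∈ S then raise y (raise x t) else raise z (raise x t)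
    have hP : IsProf P := fun i => by
      simp only [P]; split_ifs
      exacts [(h.pref.raise x).raise y, (h.pref.raise x).raise z]
    have hw : WinsAll t P x := fun a ha => by
      by_cases hay : a = y
      · subst hay
        refine Beats.wins (Q := Sᶜ) ?_ fun i hi => ?_
        · unfold Beats
          rw [card_compl, hS, Fintype.card_fin, if_pos (hx _ ha)]
          omega
        · rw [mem_compl] at hi
          simp [P, hi, raise, ha, Ne.symm hzx, Ne.symm hzy]
      · refine Beats.wins (Q := if a = z then S else univ) ?_ fun i hi => ?_
        · unfold Beats
          rw [if_pos (hx _ ha)]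
          split_ifs
          · omega
          · simp only [card_univ, Fintype.card_fin]; omega
        · simp only [P, ite_apply, raise]; grind
    have hf := h.nonneg (h.mem hP hw) x
    have hd : ∑ i, γ i * dict i P x = 0 := sum_eq_zero fun i _ => by
      rw [dict, if_neg, mul_zero]
      intro hi
      have h1 := hi y hyx
      have h2 := hi z hzx
      simp only [P, ite_apply, raise] at h1 h2; grind
    rw [winner P x hP hw, hd] at hf
    linarith
  · obtain ⟨hP, x, hw⟩ := (mem_tieCondorcetDomain_iff h.pref).1 hR
    rw [TieCondRule, condorcetWinner_tieProf_iff h.pref hP]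
    by_cases hyx : y = x
    · subst hyx
      rw [if_pos hw, winner R y hP hw, mul_one]
    · rw [if_neg fun hy => hyx (hy.unique h.pref hP hw), other R x y hP hw hyx, mul_zero, zero_add]

end Admissible

section Mixture

variable {n : ℕ} {A : Type*} [Fintype A] {t : A → A → Prop} {R R' : Prof n A} {x : A}

theorem mass_mixture {ι : Type*} [Fintype ι] (a : ℝ) (p : A → ℝ) (γ : ι → ℝ) (q : ι → A → ℝ)
    (U : Set A) : mass (fun x => a * p x + ∑ i, γ i * q i x) U =
      a * mass p U + ∑ i, γ i * mass (q i) U := by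
  have : ∀ y, U.indicator (fun x => a * p x + ∑ i, γ i * q i x) y =
      a * U.indicator p y + ∑ i, γ i * U.indicator (q i) y := by
    intro y
    by_cases hy : y ∈ U <;> simp [hy]
  simp only [mass, this, sum_add_distrib, mul_sum]
  rw [sum_comm]

theorem mass_eq_ite {P : A → Prop} (hx : P x) (hP : ∀ y, P y → y = x) (U : Set A) :
    mass (fun y => if P y then 1 else 0) U = if x ∈ U then 1 else 0 := by
  have h0 : ∀ y, y ≠ x → U.indicator (fun y => if P y then (1 : ℝ) else 0) y = 0 := by
    intro y hy
    rw [Set.indicator_apply, if_neg fun h => hy (hP y h), ite_self]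
  rw [mass, Fintype.sum_eq_single x h0, Set.indicator_apply, if_pos hx]

theorem sdDom_tieCondRule (ht : IsPref t) (hR : R ∈ TieCondorcetDomain n t)
    (hR' : R' ∈ TieCondorcetDomain n t) {i : Fin n} (hi : ∀ j, j ≠ i → R j = R' j) :
    SDdom (R i) (TieCondRule t R) (TieCondRule t R') := by
  obtain ⟨hP, w, hw⟩ := (mem_tieCondorcetDomain_iff ht).1 hR
  obtain ⟨hP', w', hw'⟩ := (mem_tieCondorcetDomain_iff ht).1 hR'
  intro x
  unfold TieCondRule
  simp only [condorcetWinner_tieProf_iff ht hP, condorcetWinner_tieProf_iff ht hP']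
  rw [mass_eq_ite hw fun y hy => hy.unique ht hP hw,
    mass_eq_ite hw' fun y hy => hy.unique ht hP' hw']
  by_cases hne : w = w'
  · rw [hne]
  have hww' : R i w w' := by
    by_contra hc
    refine (hw' w hne).not_symm ht hP' (Ne.symm hne)
      ((hw w' (Ne.symm hne)).mono fun j hj => ?_)
    have hji : j ≠ i := by
      rintro rfl
      exact hc hj
    exact hi j hji ▸ hj
  have key : w' ∈ UC (R i) x → w ∈ UC (R i) x := by
    rintro (h | rfl)
    exacts [Or.inl ((hP i).trans hww' h), Or.inl hww']
  split_ifs with h1 h2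
  exacts [le_rfl, absurd (key h1) h2, zero_le_one, le_rfl]

theorem sdDom_dict (hR : IsProf R) (hR' : IsProf R') {i : Fin n}
    (hi : ∀ j, j ≠ i → R j = R' j) (j : Fin n) : SDdom (R i) (dict j R) (dict j R') := by
  intro x
  have : Nonempty A := ⟨x⟩
  by_cases hji : j = i
  · subst hji
    obtain ⟨a, ha⟩ := (hR j).exists_topRanked
    obtain ⟨b, hb⟩ := (hR' j).exists_topRanked
    unfold dict
    rw [mass_eq_ite ha fun y hy => (hR j).topRanked_unique hy ha,
      mass_eq_ite hb fun y hy => (hR' j).topRanked_unique hy hb]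
    have hax : a ∈ UC (R j) x := by
      by_cases hxa : x = a
      exacts [Or.inr hxa.symm, Or.inl (ha x hxa)]
    rw [if_pos hax]
    split_ifs
    exacts [le_rfl, zero_le_one]
  · unfold dict
    rw [hi j hji]

theorem strategyproof_mixture (ht : IsPref t) {f : Prof n A → A → ℝ} {γC : ℝ} {γ : Fin n → ℝ}
    (hC : 0 ≤ γC) (hγ : ∀ i, 0 ≤ γ i)
    (hf : ∀ R ∈ TieCondorcetDomain n t, ∀ x,
      f R x = γC * TieCondRule t R x + ∑ i, γ i * dict i R x) :
    Strategyproof (TieCondorcetDomain n t) f := by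
  intro R hR R' hR' i hi x
  rw [funext (hf R hR), funext (hf R' hR'), mass_mixture, mass_mixture]
  exact add_le_add (mul_le_mul_of_nonneg_left (sdDom_tieCondRule ht hR hR' hi x) hC)
    (sum_le_sum fun j _ => mul_le_mul_of_nonneg_left (sdDom_dict hR.1 hR'.1 hi j x) (hγ j))

theorem nonImposing_mixture (hn : 4 ≤ n) (ht : IsPref t) {f : Prof n A → A → ℝ} {γC : ℝ}
    {γ : Fin n → ℝ} (h1 : γC + ∑ i, γ i = 1)
    (hf : ∀ R ∈ TieCondorcetDomain n t, ∀ x,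
      f R x = γC * TieCondRule t R x + ∑ i, γ i * dict i R x) :
    NonImposing (TieCondorcetDomain n t) f := by
  intro x
  have hP : IsProf fun _ : Fin n => raise x t := fun _ => ht.raise x
  have hw : WinsAll t (fun _ : Fin n => raise x t) x :=
    winsAll_of_topRanked hn fun _ => topRanked_raise t x
  have hm := (mem_tieCondorcetDomain_iff ht).2 ⟨hP, x, hw⟩
  refine ⟨_, hm, ?_⟩
  rw [hf _ hm, TieCondRule, if_pos ((condorcetWinner_tieProf_iff ht hP).2 hw)]
  simpa [dict, topRanked_raise] using h1

end Mixture

/-- For even `n ≥ 4`, an SDS on the tie-breaking Condorcet domain is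
strategyproof and non-imposing iff it is a mixture of a random dictatorship and the
tie-breaking Condorcet rule. -/
theorem sds_tieCondorcetDomain_characterization {n : ℕ} {A : Type*} [Fintype A]
    (hn : 4 ≤ n) (heven : Even n) (hA : 3 ≤ Fintype.card A)
    (t : A → A → Prop) (ht : IsPref t)
    (f : Prof n A → A → ℝ) (hf : IsSDS (TieCondorcetDomain n t) f) :
    (Strategyproof (TieCondorcetDomain n t) f ∧ NonImposing (TieCondorcetDomain n t) f) ↔
      (∃ (γC : ℝ) (γ : Fin n → ℝ), 0 ≤ γC ∧ (∀ i, 0 ≤ γ i) ∧ γC + ∑ i, γ i = 1 ∧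
        ∀ R ∈ TieCondorcetDomain n t, ∀ x,
          f R x = γC * TieCondRule t R x + ∑ i, γ i * dict i R x) := by
  exact ⟨fun ⟨hsp, hni⟩ => (Admissible.mk hn heven hA ht hf hsp hni).eq_mixture,
    fun ⟨_, _, hC, hγ, h1, hmix⟩ =>
      ⟨strategyproof_mixture ht hC hγ hmix, nonImposing_mixture hn ht h1 hmix⟩⟩
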